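/- Let M and N be finitely generated abelian groups, F a torsion-free abelian group, and let f : M → N and g : N → F be homomorphisms with ker g = im f. Suppose U' ⊆ M is a subgroup with ker f ⊆ U' such that the quotient M/U' is torsion-free. Then f(U') is a direct summand of N. -/

import Mathlib

/-- A subgroup of a finitely generated abelian group with torsion-free quotient is a direct
summand: the quotient is free, so the projection onto it splits. -/
theorem AddSubgroup.exists_isCompl_of_nsmul_mem {N : Type*} [AddCommGroup N] [AddGroup.FG N]
    (V : AddSubgroup N) (hV : ∀ (n : ℕ) (y : N), n ≠ 0 → n • y ∈ V → y ∈ V) :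
    ∃ C : AddSubgroup N, IsCompl V C := by
  have : Module.Finite ℤ N := Module.Finite.iff_addGroup_fg.mpr ‹_›
  let W : Submodule ℤ N := AddSubgroup.toIntSubmodule V
  have : IsAddTorsionFree (N ⧸ W) := by
    refine ⟨fun n hn a b hab => ?_⟩
    obtain ⟨x, rfl⟩ := W.mkQ_surjective a
    obtain ⟨y, rfl⟩ := W.mkQ_surjective b
    replace hab : n • W.mkQ x = n • W.mkQ y := hab
    rw [← map_nsmul, ← map_nsmul, ← sub_eq_zero, ← map_sub, ← smul_sub, ← LinearMap.mem_ker,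
      Submodule.ker_mkQ] at hab
    rw [← sub_eq_zero, ← map_sub, ← LinearMap.mem_ker, Submodule.ker_mkQ]
    exact hV n _ hn hab
  obtain ⟨s, hs⟩ := Module.projective_lifting_property W.mkQ LinearMap.id W.mkQ_surjective
  have hsec (q : N ⧸ W) : W.mkQ (s q) = q := LinearMap.congr_fun hs q
  refine ⟨s.toAddMonoidHom.range, ?_, ?_⟩
  · rw [AddSubgroup.disjoint_def]
    rintro _ hx ⟨q, rfl⟩
    have hq : W.mkQ (s q) = 0 := (Submodule.Quotient.mk_eq_zero W).mpr hx
    rw [hsec] at hq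
    rw [hq, map_zero]
  · rw [codisjoint_iff, eq_top_iff]
    intro x _
    have hx : x - s (W.mkQ x) ∈ W := by
      refine (Submodule.Quotient.mk_eq_zero W).mp ?_
      rw [← Submodule.mkQ_apply, map_sub, hsec, sub_self]
    exact AddSubgroup.mem_sup.mpr ⟨_, hx, _, ⟨W.mkQ x, rfl⟩, sub_add_cancel _ _⟩

/-- Let `M`, `N` be finitely generated abelian groups, `F` a torsion-free
abelian group, and `f : M → N`, `g : N → F` homomorphisms with
`ker g = im f`.  If `U' ⊆ M` is a subgroup containing `ker f` such that
`M ⧸ U'` is torsion-free, then `f(U')` is a direct summand of `N`. -/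
theorem image_direct_summand_of_torsionFree_quotient
    (M N F : Type*) [AddCommGroup M] [AddCommGroup N] [AddCommGroup F]
    [AddGroup.FG M] [AddGroup.FG N]
    (hF : ∀ (x : F) (n : ℕ), n ≠ 0 → n • x = 0 → x = 0)
    (f : M →+ N) (g : N →+ F)
    (hgf : g.ker = f.range)
    (U' : AddSubgroup M) (hker : f.ker ≤ U')
    (hquot : ∀ (x : M ⧸ U') (n : ℕ), n ≠ 0 → n • x = 0 → x = 0) :
    ∃ C : AddSubgroup N, IsCompl (U'.map f) C := by
  refine (U'.map f).exists_isCompl_of_nsmul_mem fun n y hn hy => ?_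
  obtain ⟨u, hu, huy⟩ := hy
  have hy_ker : y ∈ g.ker := by
    refine hF (g y) n hn ?_
    have hfu : f u ∈ g.ker := hgf ▸ ⟨u, rfl⟩
    rw [← map_nsmul, ← huy]
    exact hfu
  rw [hgf] at hy_ker
  obtain ⟨m, rfl⟩ := hy_ker
  have hdiff : n • m - u ∈ U' := hker <| by
    rw [AddMonoidHom.mem_ker, map_sub, map_nsmul, ← huy, sub_self]
  have hnm : n • m ∈ U' := by simpa using U'.add_mem hdiff hu
  refine ⟨m, (QuotientAddGroup.eq_zero_iff m).mp (hquot m n hn ?_), rfl⟩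
  exact (QuotientAddGroup.eq_zero_iff (n • m)).mpr hnm
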